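/- Let (P_t)_{t∈T} be a family of projection-valued measures on a complex Hilbert space H, where P_t is a PVM on (Λ_t, F_t) and each Λ_t is nonempty. Then there exists a unique normalized finitely additive L(H)-valued measure ℙ on the algebra A_Λ of cylinder sets of Λ = Π_{t∈T} Λ_t such that ℙ(π_{t₁}⁻¹(B₁) ∩ ⋯ ∩ π_{tₙ}⁻¹(Bₙ)) = (1/n!)·{P_{t₁}(B₁)·…·P_{tₙ}(Bₙ)}_sym for every finite collection of distinct indices t₁,…,tₙ ∈ T and all B₁ ∈ F_{t₁}, …, Bₙ ∈ F_{tₙ}; moreover, every value of ℙ is a self-adjoint operator. -/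

import Mathlib

open scoped BigOperators

/-- An algebra of subsets of a set `α`. -/
structure SetAlgebra (α : Type*) where
  sets : Set (Set α)
  univ_mem : Set.univ ∈ sets
  compl_mem : ∀ ⦃s : Set α⦄, s ∈ sets → sᶜ ∈ sets
  union_mem : ∀ ⦃s t : Set α⦄, s ∈ sets → t ∈ sets → s ∪ t ∈ sets

/-- A projection-valued measure on `(Λ, F)` with values in the bounded operators on `H`. -/
structure PVM (H : Type*) [NormedAddCommGroup H] [InnerProductSpace ℂ H]
    [CompleteSpace H] {Λ : Type*} (F : SetAlgebra Λ) where
  toFun : Set Λ → (H →L[ℂ] H)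
  isSelfAdjoint_of_mem : ∀ ⦃B : Set Λ⦄, B ∈ F.sets → IsSelfAdjoint (toFun B)
  idem_of_mem : ∀ ⦃B : Set Λ⦄, B ∈ F.sets → toFun B * toFun B = toFun B
  map_univ : toFun Set.univ = 1
  map_empty : toFun ∅ = 0
  map_union : ∀ ⦃B₁ B₂ : Set Λ⦄, B₁ ∈ F.sets → B₂ ∈ F.sets → Disjoint B₁ B₂ →
    toFun (B₁ ∪ B₂) = toFun B₁ + toFun B₂
  map_inter : ∀ ⦃B₁ B₂ : Set Λ⦄, B₁ ∈ F.sets → B₂ ∈ F.sets →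
    toFun (B₁ ∩ B₂) = toFun B₁ * toFun B₂

/-- The symmetrized product `{Z₁ ⋯ Zₙ}_sym`: the sum over all permutations `σ` of
the ordered operator products `Z_{σ(1)} ⋯ Z_{σ(n)}`. -/
noncomputable def symProd {H : Type*} [NormedAddCommGroup H] [InnerProductSpace ℂ H]
    [CompleteSpace H] {n : ℕ} (Z : Fin n → (H →L[ℂ] H)) : H →L[ℂ] H :=
  ∑ σ : Equiv.Perm (Fin n), (List.ofFn fun i => Z (σ i)).prod

/-- The algebra of subsets of `α` generated by a collection `G` of subsets:
the smallest collection containing `G` and `univ` and closed under complements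
and finite unions. -/
inductive GenAlg {α : Type*} (G : Set (Set α)) : Set α → Prop
  | basic {s : Set α} : s ∈ G → GenAlg G s
  | univ : GenAlg G Set.univ
  | compl {s : Set α} : GenAlg G s → GenAlg G sᶜ
  | union {s t : Set α} : GenAlg G s → GenAlg G t → GenAlg G (s ∪ t)

/-- The product algebra on `Π i, Λ i`: the algebra of subsets generated by the
rectangles `B₁ × ⋯ × Bₙ` with measurable sides `Bᵢ ∈ Fᵢ`. -/
def prodAlgebra {ι : Type*} {Λ : ι → Type*} (F : ∀ i, SetAlgebra (Λ i)) :
    Set (Set (∀ i, Λ i)) :=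
  {S | GenAlg {R | ∃ B : ∀ i, Set (Λ i), (∀ i, B i ∈ (F i).sets) ∧ R = Set.univ.pi B} S}

/-- The collection `A_Λ` of all cylinder sets of `Λ = Π_{t∈T} Λ_t`: sets of the form
`π_{(t₁,…,tₙ)}⁻¹(F)` for distinct indices `t₁,…,tₙ ∈ T` and `F` in the product algebra
on `Λ_{t₁} × ⋯ × Λ_{tₙ}`. -/
def cylinderSets {T : Type*} (Λ : T → Type*) (F : ∀ t, SetAlgebra (Λ t)) :
    Set (Set (∀ t, Λ t)) :=
  {A | ∃ (n : ℕ) (t : Fin n → T), Function.Injective t ∧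
        ∃ Fs ∈ prodAlgebra (fun j => F (t j)),
          A = (fun (x : ∀ s, Λ s) (j : Fin n) => x (t j)) ⁻¹' Fs}

section SymList

variable {T R : Type*} [Ring R] [Algebra ℂ R]

/-- Normalized symmetrized product along a list. -/
noncomputable def mlist (f : T → R) (l : List T) : R :=
  (l.length.factorial : ℂ)⁻¹ • ((l.permutations').map (fun l' => (l'.map f).prod)).sum

theorem mlist_perm (f : T → R) {l l' : List T} (h : l.Perm l') : mlist f l = mlist f l' := by
  unfold mlist
  rw [h.length_eq, (h.permutations'.map _).sum_eq]

theorem sum_aux_one (f : T → R) (a : T) (ha : f a = 1) (l : List T) :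
    ((l.permutations'Aux a).map (fun l' => (l'.map f).prod)).sum
      = ((l.length + 1 : ℕ) : R) * (l.map f).prod := by
  induction l with
  | nil => simp [ha]
  | cons y ys ih =>
    simp only [List.permutations'Aux, List.map_cons, List.map_map, List.sum_cons, Function.comp_def,
      List.prod_cons, List.sum_map_mul_left, ih, ha, List.length_cons]
    push_cast
    have := (Nat.cast_commute ys.length (f y)).eq
    simp only [add_mul, mul_add, one_mul, ← mul_assoc, this]
    abel

theorem sum_flat_one (f : T → R) (a : T) (ha : f a = 1) (n : ℕ) (L : List (List T))
    (hL : ∀ l ∈ L, l.length = n) :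
    ((L.flatMap (List.permutations'Aux a)).map (fun l' => (l'.map f).prod)).sum
      = ((n + 1 : ℕ) : R) * (L.map (fun l' => (l'.map f).prod)).sum := by
  induction L with
  | nil => simp
  | cons l L ih =>
    rw [List.flatMap_cons, List.map_append, List.sum_append, sum_aux_one f a ha,
      ih (fun l h => hL l (List.mem_cons_of_mem _ h)), hL l (List.mem_cons_self), List.map_cons,
      List.sum_cons, mul_add]

theorem mlist_cons_one (f : T → R) (a : T) (ha : f a = 1) (l : List T) :
    mlist f (a :: l) = mlist f l := by
  unfold mlist
  rw [List.permutations', sum_flat_one f a ha l.length _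
    (fun l' h => (List.mem_permutations'.1 h).length_eq), List.length_cons, Nat.factorial_succ,
    ← nsmul_eq_mul, ← Nat.cast_smul_eq_nsmul ℂ, smul_smul]
  congr 1
  have h1 : ((l.length + 1 : ℕ) : ℂ) ≠ 0 := Nat.cast_ne_zero.2 (Nat.succ_ne_zero _)
  rw [Nat.cast_mul, mul_inv, mul_comm, ← mul_assoc, mul_inv_cancel₀ h1, one_mul]

theorem mlist_append_one (f : T → R) (l l' : List T) (h : ∀ a ∈ l', f a = 1) :
    mlist f (l' ++ l) = mlist f l := by
  induction l' with
  | nil => rfl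
  | cons a l' ih =>
    rw [List.cons_append, mlist_cons_one f a (h a List.mem_cons_self)]
    exact ih fun b hb => h b (List.mem_cons_of_mem _ hb)

open Classical in
theorem mlist_filter (f : T → R) (l : List T) :
    mlist f l = mlist f (l.filter (fun a => ¬ f a = 1)) := by
  rw [← mlist_append_one f (l.filter (fun a => ¬ f a = 1)) (l.filter (fun a => f a = 1))
    (by intro a ha; simpa using (List.mem_filter.1 ha).2)]
  apply mlist_perm
  have := (List.filter_append_perm (fun a => decide (f a = 1)) l).symm
  simpa using this

theorem mlist_eq (f : T → R) {l l' : List T} (hl : l.Nodup) (hl' : l'.Nodup)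
    (h : ∀ a, f a ≠ 1 → a ∈ l) (h' : ∀ a, f a ≠ 1 → a ∈ l') : mlist f l = mlist f l' := by
  classical
  rw [mlist_filter f l, mlist_filter f l']
  apply mlist_perm
  rw [List.perm_ext_iff_of_nodup (hl.filter _) (hl'.filter _)]
  intro a
  simp only [List.mem_filter]
  constructor
  · rintro ⟨_, h2⟩
    exact ⟨h' a (by simpa using h2), h2⟩
  · rintro ⟨_, h2⟩
    exact ⟨h a (by simpa using h2), h2⟩

theorem nodup_permutations'_of {l : List T} (hl : l.Nodup) : l.permutations'.Nodup :=
  (List.permutations_perm_permutations' l).nodup_iff.1 (List.nodup_permutations l hl)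

theorem mlist_selfAdjoint [StarRing R] [StarModule ℂ R] (f : T → R) {l : List T} (hl : l.Nodup)
    (hf : ∀ a ∈ l, IsSelfAdjoint (f a)) : IsSelfAdjoint (mlist f l) := by
  have key : (l.permutations'.map List.reverse).Perm l.permutations' := by
    rw [List.perm_ext_iff_of_nodup ((nodup_permutations'_of hl).map List.reverse_injective)
      (nodup_permutations'_of hl)]
    intro a
    simp only [List.mem_map, List.mem_permutations']
    constructor
    · rintro ⟨b, hb, rfl⟩
      exact (List.reverse_perm b).trans hb
    · intro h
      exact ⟨a.reverse, (List.reverse_perm a).trans h, List.reverse_reverse a⟩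
  have hstar : ∀ l' : List T, (∀ a ∈ l', IsSelfAdjoint (f a)) →
      star (l'.map f).prod = (l'.reverse.map f).prod := by
    intro l' h
    induction l' with
    | nil => simp
    | cons a l' ih =>
      simp [ih (fun b hb => h b (List.mem_cons_of_mem _ hb)),
        (h a List.mem_cons_self).star_eq]
  have hsum : ∀ L : List (List T), (∀ l' ∈ L, ∀ a ∈ l', IsSelfAdjoint (f a)) →
      star ((L.map (fun l' => (l'.map f).prod)).sum)
        = ((L.map List.reverse).map (fun l' => (l'.map f).prod)).sum := by
    intro L h
    induction L with
    | nil => simp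
    | cons l' L ih =>
      rw [List.map_cons, List.sum_cons, star_add, hstar l' (h l' List.mem_cons_self),
        ih (fun b hb => h b (List.mem_cons_of_mem _ hb))]
      simp
  unfold mlist
  rw [IsSelfAdjoint, star_smul, hsum _ (fun l' hl' a ha =>
    hf a ((List.mem_permutations'.1 hl').mem_iff.1 ha)), (key.map _).sum_eq]
  simp

theorem mlist_ofFn (f : T → R) {n : ℕ} (t : Fin n → T) (ht : Function.Injective t) :
    mlist f (List.ofFn t) = (n.factorial : ℂ)⁻¹ •
      ∑ σ : Equiv.Perm (Fin n), (List.ofFn fun i => f (t (σ i))).prod := by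
  classical
  unfold mlist
  rw [List.length_ofFn]
  congr 1
  have hnd := nodup_permutations'_of (List.nodup_ofFn.2 ht)
  rw [← List.sum_toFinset _ hnd]
  have hinj : Function.Injective (fun σ : Equiv.Perm (Fin n) => List.ofFn (t ∘ σ)) := by
    intro σ τ h
    have := List.ofFn_injective h
    ext i
    exact congrArg _ (ht (congrFun this i))
  have himg : (Finset.univ.image (fun σ : Equiv.Perm (Fin n) => List.ofFn (t ∘ σ)))
      = (List.ofFn t).permutations'.toFinset := by
    apply Finset.eq_of_subset_of_card_le
    · intro l hl
      obtain ⟨σ, _, rfl⟩ := Finset.mem_image.1 hl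
      rw [List.mem_toFinset, List.mem_permutations']
      exact Equiv.Perm.ofFn_comp_perm σ t
    · rw [Finset.card_image_of_injective _ hinj, List.toFinset_card_of_nodup hnd,
        ← (List.permutations_perm_permutations' _).length_eq, List.length_permutations]
      simp [Fintype.card_perm]
  rw [← himg, Finset.sum_image (fun a _ b _ h => hinj h)]
  simp [List.map_ofFn, Function.comp_def]

end SymList

/-- One-dimensional linearity lemma for finitely additive set functions. -/
theorem one_dim {α R κ : Type*} [Ring R] (F : SetAlgebra α) (m : Set α → R)
    (h0 : m ∅ = 0)
    (hm : ∀ ⦃A B : Set α⦄, A ∈ F.sets → B ∈ F.sets → Disjoint A B → m (A ∪ B) = m A + m B)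
    (hinter : ∀ ⦃A B : Set α⦄, A ∈ F.sets → B ∈ F.sets → A ∩ B ∈ F.sets)
    (B : κ → Set α) (b : κ → R) (K : Finset κ) (hB : ∀ k ∈ K, B k ∈ F.sets) :
    ∀ (C : Set α) (d : R), C ∈ F.sets →
      (∀ y ∈ C, ∑ k ∈ K, (B k).indicator (fun _ => b k) y = d) →
      ∑ k ∈ K, m (B k ∩ C) * b k = m C * d := by
  classical
  induction K using Finset.induction_on with
  | empty =>
    intro C d hC h
    rcases C.eq_empty_or_nonempty with rfl | ⟨y, hy⟩
    · simp [h0]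
    · have := h y hy
      simp at this
      simp [← this]
  | insert k K hk ih =>
    intro C d hC h
    have hBk := hB k (Finset.mem_insert_self _ _)
    have hBK : ∀ j ∈ K, B j ∈ F.sets := fun j hj => hB j (Finset.mem_insert_of_mem hj)
    have hC1 : B k ∩ C ∈ F.sets := hinter hBk hC
    have hC2 : (B k)ᶜ ∩ C ∈ F.sets := hinter (F.compl_mem hBk) hC
    have i1 := ih hBK (B k ∩ C) (d - b k) hC1 (by
      intro y hy
      have := h y hy.2
      rw [Finset.sum_insert hk, Set.indicator_of_mem hy.1] at this
      rw [← this]; abel)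
    have i2 := ih hBK ((B k)ᶜ ∩ C) d hC2 (by
      intro y hy
      have := h y hy.2
      rwa [Finset.sum_insert hk, Set.indicator_of_notMem hy.1, zero_add] at this)
    have split : ∀ D ∈ F.sets, m D = m (D ∩ B k) + m (D ∩ (B k)ᶜ) := by
      intro D hD
      rw [← hm (hinter hD hBk) (hinter hD (F.compl_mem hBk)), Set.inter_union_compl]
      exact Set.disjoint_left.2 fun y h1 h2 => h2.2 h1.2
    have e : ∑ j ∈ K, m (B j ∩ C) * b j
        = ∑ j ∈ K, m (B j ∩ (B k ∩ C)) * b j + ∑ j ∈ K, m (B j ∩ ((B k)ᶜ ∩ C)) * b j := by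
      rw [← Finset.sum_add_distrib]
      refine Finset.sum_congr rfl fun j hj => ?_
      rw [split _ (hinter (hBK j hj) hC), add_mul, Set.inter_assoc, Set.inter_assoc,
        Set.inter_comm C, Set.inter_comm C]
    rw [Finset.sum_insert hk, e, i1, i2, split C hC, Set.inter_comm C, Set.inter_comm C]
    simp only [mul_sub, add_mul]
    abel

theorem SetAlgebra.inter_mem' {α : Type*} (F : SetAlgebra α) ⦃A B : Set α⦄ (hA : A ∈ F.sets)
    (hB : B ∈ F.sets) : A ∩ B ∈ F.sets := by
  have := F.compl_mem (F.union_mem (F.compl_mem hA) (F.compl_mem hB))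
  rwa [Set.compl_union, compl_compl, compl_compl] at this

section Main

variable {H : Type*} [NormedAddCommGroup H] [InnerProductSpace ℂ H] [CompleteSpace H]
    {T : Type*} {Λ : T → Type*} {F : ∀ t, SetAlgebra (Λ t)}

/-- Joint linearity lemma: ordered products of PVMs respect linear relations of rectangles. -/
theorem multi_dim [∀ t, Nonempty (Λ t)] (P : ∀ t, PVM H (F t)) {κ : Type*} (K : Finset κ)
    (B : κ → ∀ t, Set (Λ t)) (hB : ∀ k t, B k t ∈ (F t).sets) :
    ∀ (l : List T), l.Nodup → ∀ (c : κ → (H →L[ℂ] H)),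
      (∀ x : ∀ t, Λ t, ∑ k ∈ K, {x | ∀ t ∈ l, x t ∈ B k t}.indicator (fun _ => c k) x = 0) →
      ∑ k ∈ K, (l.map fun t => (P t).toFun (B k t)).prod * c k = 0 := by
  classical
  intro l
  induction l with
  | nil =>
    intro _ c h
    have := h (fun t => Classical.arbitrary _)
    simpa using this
  | cons t l ih =>
    intro hnd c h
    obtain ⟨htl, hl⟩ := List.nodup_cons.1 hnd
    have h1 := one_dim (F t) (P t).toFun (P t).map_empty (P t).map_union (F t).inter_mem'
      (fun k => B k t) (fun k => (l.map fun t => (P t).toFun (B k t)).prod * c k) K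
      (fun k _ => hB k t) Set.univ 0 (F t).univ_mem (by
        intro y _
        have := ih hl (fun k => (B k t).indicator (fun _ => c k) y) (by
          intro x
          rw [← h (Function.update x t y)]
          refine Finset.sum_congr rfl fun k _ => ?_
          have e : (∀ u ∈ l, Function.update x t y u ∈ B k u) ↔ (∀ u ∈ l, x u ∈ B k u) := by
            refine forall₂_congr fun u hu => ?_
            rw [Function.update_of_ne (by rintro rfl; exact htl hu)]
          by_cases h1 : y ∈ B k t <;> by_cases h2 : ∀ u ∈ l, x u ∈ B k u <;>
            simp [Set.indicator, h1, h2, e])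
        rw [← this]
        refine Finset.sum_congr rfl fun k _ => ?_
        by_cases h1 : y ∈ B k t <;> simp [Set.indicator, h1])
    simpa [mul_assoc] using h1

/-- Measurable rectangles in the product depending on finitely many coordinates. -/
def Rect (F : ∀ t, SetAlgebra (Λ t)) :=
  {B : ∀ t, Set (Λ t) // (∀ t, B t ∈ (F t).sets) ∧ {t | B t ≠ Set.univ}.Finite}

def Rect.set (R : Rect F) : Set (∀ t, Λ t) := {x | ∀ t, x t ∈ R.1 t}

noncomputable def Rect.supp (R : Rect F) : Finset T := R.2.2.toFinset

theorem Rect.mem_supp (R : Rect F) (t : T) : t ∈ R.supp ↔ R.1 t ≠ Set.univ := by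
  simp [Rect.supp]

noncomputable def rectM (P : ∀ t, PVM H (F t)) (R : Rect F) : H →L[ℂ] H :=
  mlist (fun t => (P t).toFun (R.1 t)) R.supp.toList

theorem rectM_eq (P : ∀ t, PVM H (F t)) (R : Rect F) {l : List T} (hl : l.Nodup)
    (h : ∀ t, R.1 t ≠ Set.univ → t ∈ l) :
    rectM P R = mlist (fun t => (P t).toFun (R.1 t)) l := by
  have aux : ∀ t, (P t).toFun (R.1 t) ≠ 1 → R.1 t ≠ Set.univ := by
    intro t ht hu
    exact ht (by rw [hu, (P t).map_univ])
  refine mlist_eq _ (Finset.nodup_toList _) hl ?_ ?_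
  · intro a ha
    rw [Finset.mem_toList, Rect.mem_supp]
    exact aux a ha
  · intro a ha
    exact h a (aux a ha)

theorem rectM_selfAdjoint (P : ∀ t, PVM H (F t)) (R : Rect F) : IsSelfAdjoint (rectM P R) :=
  mlist_selfAdjoint _ (Finset.nodup_toList _) fun a _ => (P a).isSelfAdjoint_of_mem (R.2.1 a)

noncomputable def rectEv (F : ∀ t, SetAlgebra (Λ t)) :
    (Rect F →₀ ℤ) →ₗ[ℤ] ((∀ t, Λ t) → ℤ) :=
  Finsupp.linearCombination ℤ fun R => R.set.indicator 1

noncomputable def rectVal (P : ∀ t, PVM H (F t)) : (Rect F →₀ ℤ) →ₗ[ℤ] (H →L[ℂ] H) :=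
  Finsupp.linearCombination ℤ (rectM P)

theorem list_sum_swap {κ β R : Type*} [Ring R] (K : Finset κ) (g : κ → β → R) (c : κ → R)
    (L : List β) :
    ∑ k ∈ K, (L.map (g k)).sum * c k = (L.map fun b => ∑ k ∈ K, g k b * c k).sum := by
  induction L with
  | nil => simp
  | cons b L ih => simp [add_mul, Finset.sum_add_distrib, ih]

theorem rectVal_eq_zero [∀ t, Nonempty (Λ t)] (P : ∀ t, PVM H (F t)) (g : Rect F →₀ ℤ)
    (hg : rectEv F g = 0) : rectVal P g = 0 := by
  classical
  set l := (g.support.biUnion Rect.supp).toList with hl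
  have hnd : l.Nodup := Finset.nodup_toList _
  have hmem : ∀ R ∈ g.support, ∀ t, R.1 t ≠ Set.univ → t ∈ l := by
    intro R hR t ht
    rw [hl, Finset.mem_toList, Finset.mem_biUnion]
    exact ⟨R, hR, (R.mem_supp t).2 ht⟩
  have hx : ∀ x, ∑ R ∈ g.support, R.set.indicator (fun _ => ((g R : ℤ) : H →L[ℂ] H)) x = 0 := by
    intro x
    have := congrFun hg x
    rw [rectEv, Finsupp.linearCombination_apply, Finsupp.sum, Finset.sum_apply] at this
    have h2 := congrArg (fun z : ℤ => (z : H →L[ℂ] H)) this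
    simp only [Int.cast_sum, Pi.zero_apply, Int.cast_zero] at h2
    rw [← h2]
    refine Finset.sum_congr rfl fun R _ => ?_
    by_cases h : x ∈ R.set <;> simp [h]
  have e : rectVal P g = ∑ R ∈ g.support,
      mlist (fun t => (P t).toFun (R.1 t)) l * ((g R : ℤ) : H →L[ℂ] H) := by
    rw [rectVal, Finsupp.linearCombination_apply, Finsupp.sum]
    refine Finset.sum_congr rfl fun R hR => ?_
    rw [rectM_eq P R hnd (hmem R hR), zsmul_eq_mul, (Int.cast_commute _ _).eq]
  rw [e]
  unfold mlist
  simp only [smul_mul_assoc]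
  rw [← Finset.smul_sum, list_sum_swap]
  convert smul_zero _
  apply List.sum_eq_zero
  intro z hz
  obtain ⟨l', hl', rfl⟩ := List.mem_map.1 hz
  rw [List.mem_permutations'] at hl'
  refine multi_dim P g.support (fun R => R.1) (fun R => R.2.1) l' (hl'.nodup_iff.2 hnd) _ ?_
  intro x
  rw [← hx x]
  refine Finset.sum_congr rfl fun R hR => ?_
  have : {x : ∀ t, Λ t | ∀ t ∈ l', x t ∈ R.1 t} = R.set := by
    ext x
    refine ⟨fun h t => ?_, fun h t _ => h t⟩
    by_cases ht : R.1 t = Set.univ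
    · rw [ht]; trivial
    · exact h t (hl'.mem_iff.2 (hmem R hR t ht))
  rw [this]

theorem rectVal_selfAdjoint (P : ∀ t, PVM H (F t)) (g : Rect F →₀ ℤ) :
    IsSelfAdjoint (rectVal P g) := by
  rw [rectVal, Finsupp.linearCombination_apply, Finsupp.sum]
  refine isSelfAdjoint_sum _ fun R _ => ?_
  rw [IsSelfAdjoint, star_zsmul, (rectM_selfAdjoint P R).star_eq]

open Classical in
/-- The operator-valued measure. -/
noncomputable def cylM (P : ∀ t, PVM H (F t)) (A : Set (∀ t, Λ t)) : H →L[ℂ] H :=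
  if h : ∃ g, rectEv F g = A.indicator 1 then rectVal P h.choose else 0

theorem cylM_eq [∀ t, Nonempty (Λ t)] (P : ∀ t, PVM H (F t)) {A : Set (∀ t, Λ t)}
    {g : Rect F →₀ ℤ} (hg : rectEv F g = A.indicator 1) : cylM P A = rectVal P g := by
  have h : ∃ g, rectEv F g = A.indicator 1 := ⟨g, hg⟩
  rw [cylM, dif_pos h, ← sub_eq_zero, ← map_sub]
  apply rectVal_eq_zero
  rw [map_sub, h.choose_spec, hg, sub_self]

theorem rectEv_single (R : Rect F) : rectEv F (Finsupp.single R 1) = R.set.indicator 1 := by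
  simp [rectEv]

theorem cylM_rect [∀ t, Nonempty (Λ t)] (P : ∀ t, PVM H (F t)) (R : Rect F) :
    cylM P R.set = rectM P R := by
  rw [cylM_eq P (rectEv_single R)]
  simp [rectVal]

def Rect.univ (F : ∀ t, SetAlgebra (Λ t)) : Rect F :=
  ⟨fun _ => Set.univ, fun t => (F t).univ_mem, by simp⟩

theorem Rect.univ_set : (Rect.univ F).set = Set.univ := by
  ext x; simp [Rect.univ, Rect.set]

def Rect.inter (R S : Rect F) : Rect F :=
  ⟨fun t => R.1 t ∩ S.1 t, fun t => (F t).inter_mem' (R.2.1 t) (S.2.1 t), by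
    refine (R.2.2.union S.2.2).subset fun t ht => ?_
    by_contra h
    simp only [Set.mem_union, Set.mem_ofPred_eq, not_or, not_not] at h
    refine ht ?_
    show R.1 t ∩ S.1 t = Set.univ
    rw [h.1, h.2, Set.inter_univ]⟩

theorem Rect.inter_set (R S : Rect F) : (R.inter S).set = R.set ∩ S.set := by
  ext x
  simp only [Rect.set, Rect.inter, Set.mem_ofPred_eq, Set.mem_inter_iff]
  exact forall_and

theorem rectEv_mul (g h : Rect F →₀ ℤ) : ∃ k, rectEv F k = rectEv F g * rectEv F h := by
  induction g using Finsupp.induction_linear with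
  | zero => exact ⟨0, by simp⟩
  | add a b iha ihb =>
    obtain ⟨k, hk⟩ := iha
    obtain ⟨k', hk'⟩ := ihb
    exact ⟨k + k', by rw [map_add, map_add, hk, hk', add_mul]⟩
  | single R c =>
    induction h using Finsupp.induction_linear with
    | zero => exact ⟨0, by simp⟩
    | add a b iha ihb =>
      obtain ⟨k, hk⟩ := iha
      obtain ⟨k', hk'⟩ := ihb
      exact ⟨k + k', by rw [map_add, map_add, hk, hk', mul_add]⟩
    | single S d =>
      refine ⟨Finsupp.single (R.inter S) (c * d), ?_⟩
      simp only [rectEv, Finsupp.linearCombination_single, Rect.inter_set]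
      ext x
      by_cases h1 : x ∈ R.set <;> by_cases h2 : x ∈ S.set <;> simp [h1, h2]

theorem rep_genAlg {G : Set (Set (∀ t, Λ t))} (hG : ∀ A ∈ G, ∃ R : Rect F, R.set = A)
    {A : Set (∀ t, Λ t)} (hA : GenAlg G A) : ∃ g, rectEv F g = A.indicator 1 := by
  induction hA with
  | basic h =>
    obtain ⟨R, rfl⟩ := hG _ h
    exact ⟨_, rectEv_single R⟩
  | univ => exact ⟨_, by rw [rectEv_single (Rect.univ F), Rect.univ_set]⟩
  | @compl s _ ih =>
    obtain ⟨g, hg⟩ := ih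
    refine ⟨Finsupp.single (Rect.univ F) 1 - g, ?_⟩
    rw [map_sub, hg, rectEv_single, Rect.univ_set]
    ext x
    by_cases h : x ∈ s <;> simp [h]
  | @union s t _ _ ih1 ih2 =>
    obtain ⟨g, hg⟩ := ih1
    obtain ⟨h, hh⟩ := ih2
    obtain ⟨k, hk⟩ := rectEv_mul g h
    refine ⟨g + h - k, ?_⟩
    rw [map_sub, map_add, hk, hg, hh]
    ext x
    by_cases h1 : x ∈ s <;> by_cases h2 : x ∈ t <;> simp [h1, h2]

/-- Generators over a finite set of coordinates. -/
def gens (F : ∀ t, SetAlgebra (Λ t)) (s : Finset T) : Set (Set (∀ t, Λ t)) :=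
  {A | ∃ R : Rect F, R.supp ⊆ s ∧ A = R.set}

theorem GenAlg.mono' {α : Type*} {G G' : Set (Set α)} (h : G ⊆ G') {A : Set α}
    (hA : GenAlg G A) : GenAlg G' A := by
  induction hA with
  | basic hs => exact .basic (h hs)
  | univ => exact .univ
  | compl _ ih => exact .compl ih
  | union _ _ ih1 ih2 => exact .union ih1 ih2

theorem GenAlg.preimage' {α β : Type*} (f : α → β) {G : Set (Set β)} {A : Set β}
    (hA : GenAlg G A) : GenAlg ((fun s => f ⁻¹' s) '' G) (f ⁻¹' A) := by
  induction hA with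
  | basic hs => exact .basic ⟨_, hs, rfl⟩
  | univ => exact .univ
  | compl _ ih => exact .compl ih
  | union _ _ ih1 ih2 => exact .union ih1 ih2

theorem GenAlg.of_preimage' {α β : Type*} (f : α → β) {G : Set (Set β)} {A : Set α}
    (hA : GenAlg ((fun s => f ⁻¹' s) '' G) A) : ∃ A', GenAlg G A' ∧ A = f ⁻¹' A' := by
  induction hA with
  | basic hs =>
    obtain ⟨s, hs, rfl⟩ := hs
    exact ⟨s, .basic hs, rfl⟩
  | univ => exact ⟨_, .univ, rfl⟩
  | compl _ ih =>
    obtain ⟨s, hs, rfl⟩ := ih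
    exact ⟨_, .compl hs, rfl⟩
  | union _ _ ih1 ih2 =>
    obtain ⟨s, hs, rfl⟩ := ih1
    obtain ⟨t, ht, rfl⟩ := ih2
    exact ⟨_, .union hs ht, rfl⟩

/-- Extend a rectangle on finitely many coordinates. -/
theorem exists_rect {n : ℕ} (t : Fin n → T) (ht : Function.Injective t)
    (B : ∀ i : Fin n, Set (Λ (t i))) (hB : ∀ i, B i ∈ (F (t i)).sets) :
    ∃ R : Rect F, (∀ i, R.1 (t i) = B i) ∧ (∀ u, R.1 u ≠ Set.univ → ∃ i, t i = u) := by
  have key : ∀ u, ∃ S : Set (Λ u), S ∈ (F u).sets ∧ (∀ i (h : t i = u), h ▸ B i = S) ∧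
      (S ≠ Set.univ → ∃ i, t i = u) := by
    intro u
    by_cases hu : ∃ i, t i = u
    · obtain ⟨i, rfl⟩ := hu
      refine ⟨B i, hB i, ?_, fun _ => ⟨i, rfl⟩⟩
      intro j h
      obtain rfl := ht h
      rfl
    · exact ⟨Set.univ, (F u).univ_mem, fun i h => (hu ⟨i, h⟩).elim, fun h => (h rfl).elim⟩
  choose S h1 h2 h3 using key
  refine ⟨⟨S, h1, (Set.finite_range t).subset fun u hu => h3 u hu⟩, fun i => (h2 _ i rfl).symm, h3⟩

theorem rect_set_eq {n : ℕ} (t : Fin n → T) (R : Rect F)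
    (h : ∀ u, R.1 u ≠ Set.univ → ∃ i, t i = u) :
    R.set = ⋂ i : Fin n, (fun x : ∀ s, Λ s => x (t i)) ⁻¹' R.1 (t i) := by
  ext x
  simp only [Rect.set, Set.mem_ofPred_eq, Set.mem_iInter, Set.mem_preimage]
  refine ⟨fun hx i => hx _, fun hx u => ?_⟩
  by_cases hu : R.1 u = Set.univ
  · rw [hu]; trivial
  · obtain ⟨i, rfl⟩ := h u hu
    exact hx i

theorem rectM_symProd (P : ∀ t, PVM H (F t)) {n : ℕ} (t : Fin n → T)
    (ht : Function.Injective t) (R : Rect F) (h : ∀ u, R.1 u ≠ Set.univ → ∃ i, t i = u) :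
    rectM P R = (n.factorial : ℂ)⁻¹ • symProd (fun i => (P (t i)).toFun (R.1 (t i))) := by
  rw [rectM_eq P R (List.nodup_ofFn.2 ht) (by
    intro u hu
    rw [List.mem_ofFn]
    exact h u hu), mlist_ofFn _ t ht]
  rfl

theorem mem_cylinderSets_iff (A : Set (∀ t, Λ t)) :
    A ∈ cylinderSets Λ F ↔ ∃ s : Finset T, GenAlg (gens F s) A := by
  classical
  constructor
  · rintro ⟨n, t, ht, Fs, hFs, rfl⟩
    refine ⟨Finset.univ.image t, (GenAlg.preimage' _ hFs).mono' ?_⟩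
    rintro _ ⟨_, ⟨B, hB, rfl⟩, rfl⟩
    obtain ⟨R, hR1, hR2⟩ := exists_rect (F := F) t ht B hB
    refine ⟨R, ?_, ?_⟩
    · intro u hu
      obtain ⟨i, rfl⟩ := hR2 u ((R.mem_supp u).1 hu)
      simp
    · rw [rect_set_eq t R hR2]
      ext x
      simp [hR1]
  · rintro ⟨s, hs⟩
    set t : Fin s.card → T := fun i => (s.equivFin.symm i : T) with htdef
    have ht : Function.Injective t := Subtype.val_injective.comp s.equivFin.symm.injective
    obtain ⟨A', hA', rfl⟩ := GenAlg.of_preimage'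
      (fun (x : ∀ s, Λ s) (j : Fin s.card) => x (t j))
      (G := {R | ∃ B : ∀ i, Set (Λ (t i)), (∀ i, B i ∈ (F (t i)).sets) ∧ R = Set.univ.pi B})
      (hs.mono' (by
        rintro _ ⟨R, hR, rfl⟩
        refine ⟨_, ⟨fun i => R.1 (t i), fun i => R.2.1 _, rfl⟩, ?_⟩
        rw [rect_set_eq t R (by
          intro u hu
          have hus := hR ((R.mem_supp u).2 hu)
          exact ⟨s.equivFin ⟨u, hus⟩, by simp [htdef]⟩)]
        ext x
        simp))
    exact ⟨_, t, ht, A', hA', rfl⟩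

theorem gens_mono {s s' : Finset T} (h : s ⊆ s') : gens F s ⊆ gens F s' := by
  rintro _ ⟨R, hR, rfl⟩
  exact ⟨R, hR.trans h, rfl⟩

/-- Cylinder sets form an algebra. -/
def cylAlg (Λ : T → Type*) (F : ∀ t, SetAlgebra (Λ t)) : SetAlgebra (∀ t, Λ t) where
  sets := cylinderSets Λ F
  univ_mem := (mem_cylinderSets_iff _).2 ⟨∅, .univ⟩
  compl_mem := by
    intro A hA
    obtain ⟨s, hs⟩ := (mem_cylinderSets_iff _).1 hA
    exact (mem_cylinderSets_iff _).2 ⟨s, .compl hs⟩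
  union_mem := by
    classical
    intro A B hA hB
    obtain ⟨s, hs⟩ := (mem_cylinderSets_iff _).1 hA
    obtain ⟨s', hs'⟩ := (mem_cylinderSets_iff _).1 hB
    exact (mem_cylinderSets_iff _).2 ⟨s ∪ s', .union
      (hs.mono' (gens_mono Finset.subset_union_left))
      (hs'.mono' (gens_mono Finset.subset_union_right))⟩

theorem rect_mem_cyl (R : Rect F) : R.set ∈ cylinderSets Λ F :=
  (mem_cylinderSets_iff _).2 ⟨R.supp, .basic ⟨R, subset_rfl, rfl⟩⟩

theorem exists_rep {A : Set (∀ t, Λ t)} (hA : A ∈ cylinderSets Λ F) :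
    ∃ g, rectEv F g = A.indicator 1 := by
  obtain ⟨s, hs⟩ := (mem_cylinderSets_iff _).1 hA
  exact rep_genAlg (by rintro _ ⟨R, _, rfl⟩; exact ⟨R, rfl⟩) hs

/-- A finitely additive measure on cylinder sets is determined by its values on rectangles. -/
theorem unique_aux (P : ∀ t, PVM H (F t)) (m : Set (∀ t, Λ t) → (H →L[ℂ] H))
    (hm : ∀ ⦃A B : Set (∀ t, Λ t)⦄, A ∈ cylinderSets Λ F → B ∈ cylinderSets Λ F →
        Disjoint A B → m (A ∪ B) = m A + m B)
    (hR : ∀ R : Rect F, m R.set = rectM P R) {A : Set (∀ t, Λ t)}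
    (hA : A ∈ cylinderSets Λ F) {g : Rect F →₀ ℤ} (hg : rectEv F g = A.indicator 1) :
    m A = rectVal P g := by
  have hAc : Aᶜ ∈ cylinderSets Λ F := (cylAlg Λ F).compl_mem hA
  have hunivc : Set.univ ∈ cylinderSets Λ F := (cylAlg Λ F).univ_mem
  have hempty : (∅ : Set (∀ t, Λ t)) ∈ cylinderSets Λ F := by
    have := (cylAlg Λ F).compl_mem hunivc
    rwa [Set.compl_univ] at this
  have h0 : m ∅ = 0 := by
    have := hm hempty hempty (by simp)
    rw [Set.union_empty] at this
    simpa using this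
  have hx : ∀ x, ∑ R ∈ g.support, R.set.indicator (fun _ => ((g R : ℤ) : H →L[ℂ] H)) x
      = (((A.indicator 1 x : ℤ)) : H →L[ℂ] H) := by
    intro x
    have := congrFun hg x
    rw [rectEv, Finsupp.linearCombination_apply, Finsupp.sum, Finset.sum_apply] at this
    rw [← this, Int.cast_sum]
    refine Finset.sum_congr rfl fun R _ => ?_
    by_cases h : x ∈ R.set <;> simp [h]
  have key := one_dim (cylAlg Λ F) m h0 hm (cylAlg Λ F).inter_mem' (fun R : Rect F => R.set)
    (fun R => ((g R : ℤ) : H →L[ℂ] H)) g.support (fun R _ => rect_mem_cyl R)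
  have k1 := key A 1 hA (fun y hy => by rw [hx]; simp [hy])
  have k2 := key Aᶜ 0 hAc (fun y hy => by rw [hx]; simp [Set.indicator_of_notMem hy])
  rw [mul_one] at k1
  rw [mul_zero] at k2
  rw [← add_zero (m A), ← k1, ← k2, ← Finset.sum_add_distrib, rectVal,
    Finsupp.linearCombination_apply, Finsupp.sum]
  refine Finset.sum_congr rfl fun R _ => ?_
  rw [← add_mul, ← hm ((cylAlg Λ F).inter_mem' (rect_mem_cyl R) hA)
    ((cylAlg Λ F).inter_mem' (rect_mem_cyl R) hAc), Set.inter_union_compl, hR, zsmul_eq_mul,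
    (Int.cast_commute _ _).eq]
  exact Set.disjoint_left.2 fun y h1 h2 => h2.2 h1.2

end Main

/-- **Theorem 1 of the paper.** For a family `(P_t)_{t∈T}` of PVMs on
nonempty spaces `(Λ_t, F_t)` there exists a unique normalized finitely additive
`L(H)`-valued measure `ℙ` on the algebra of cylinder sets of `Λ = Π_{t∈T} Λ_t` such that
`ℙ(π_{t₁}⁻¹(B₁) ∩ ⋯ ∩ π_{tₙ}⁻¹(Bₙ)) = (1/n!)·{P_{t₁}(B₁)⋯P_{tₙ}(Bₙ)}_sym` for all finite
collections of distinct indices and all `Bᵢ ∈ F_{tᵢ}`; moreover, every value of `ℙ` is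
self-adjoint. -/
theorem exists_unique_operator_valued_extension_of_PVMs
    {H : Type*} [NormedAddCommGroup H] [InnerProductSpace ℂ H] [CompleteSpace H]
    {T : Type*} [Nonempty T] {Λ : T → Type*} [∀ t, Nonempty (Λ t)]
    {F : ∀ t, SetAlgebra (Λ t)} (P : ∀ t, PVM H (F t)) :
    ∃ ℙ : Set (∀ t, Λ t) → (H →L[ℂ] H),
      ℙ Set.univ = 1 ∧
      (∀ ⦃A B : Set (∀ t, Λ t)⦄, A ∈ cylinderSets Λ F → B ∈ cylinderSets Λ F →
        Disjoint A B → ℙ (A ∪ B) = ℙ A + ℙ B) ∧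
      (∀ (n : ℕ) (t : Fin n → T), Function.Injective t →
        ∀ (B : ∀ i : Fin n, Set (Λ (t i))), (∀ i, B i ∈ (F (t i)).sets) →
          ℙ (⋂ i : Fin n, (fun x : ∀ s, Λ s => x (t i)) ⁻¹' B i) =
            (n.factorial : ℂ)⁻¹ • symProd (fun i => (P (t i)).toFun (B i))) ∧
      (∀ A ∈ cylinderSets Λ F, IsSelfAdjoint (ℙ A)) ∧
      (∀ ℙ' : Set (∀ t, Λ t) → (H →L[ℂ] H),
        ℙ' Set.univ = 1 →
        (∀ ⦃A B : Set (∀ t, Λ t)⦄, A ∈ cylinderSets Λ F → B ∈ cylinderSets Λ F →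
          Disjoint A B → ℙ' (A ∪ B) = ℙ' A + ℙ' B) →
        (∀ (n : ℕ) (t : Fin n → T), Function.Injective t →
          ∀ (B : ∀ i : Fin n, Set (Λ (t i))), (∀ i, B i ∈ (F (t i)).sets) →
            ℙ' (⋂ i : Fin n, (fun x : ∀ s, Λ s => x (t i)) ⁻¹' B i) =
              (n.factorial : ℂ)⁻¹ • symProd (fun i => (P (t i)).toFun (B i))) →
        ∀ A ∈ cylinderSets Λ F, ℙ' A = ℙ A) := by
  have hprod : ∀ (n : ℕ) (t : Fin n → T), Function.Injective t →
        ∀ (B : ∀ i : Fin n, Set (Λ (t i))), (∀ i, B i ∈ (F (t i)).sets) →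
          cylM P (⋂ i : Fin n, (fun x : ∀ s, Λ s => x (t i)) ⁻¹' B i) =
            (n.factorial : ℂ)⁻¹ • symProd (fun i => (P (t i)).toFun (B i)) := by
    intro n t ht B hB
    obtain ⟨R, hR1, hR2⟩ := exists_rect (F := F) t ht B hB
    obtain rfl : (fun i => R.1 (t i)) = B := funext hR1
    rw [← rect_set_eq t R hR2, cylM_rect, rectM_symProd P t ht R hR2]
  refine ⟨cylM P, ?_, ?_, hprod, ?_, ?_⟩
  · rw [← Rect.univ_set (F := F), cylM_rect, rectM_eq P (Rect.univ F) (l := []) List.nodup_nil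
      (fun t ht => (ht rfl).elim)]
    simp [mlist]
  · intro A B hA hB hAB
    obtain ⟨g, hg⟩ := exists_rep hA
    obtain ⟨h, hh⟩ := exists_rep hB
    rw [cylM_eq P hg, cylM_eq P hh, ← map_add]
    apply cylM_eq
    rw [map_add, hg, hh, Set.indicator_union_of_disjoint hAB]
    rfl
  · intro A hA
    obtain ⟨g, hg⟩ := exists_rep hA
    rw [cylM_eq P hg]
    exact rectVal_selfAdjoint P g
  · intro m _ hadd hm A hA
    obtain ⟨g, hg⟩ := exists_rep hA
    rw [cylM_eq P hg]
    refine unique_aux P m hadd (fun R => ?_) hA hg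
    set t : Fin R.supp.toList.length → T := fun i => R.supp.toList.get i with htdef
    have ht : Function.Injective t := List.nodup_iff_injective_get.1 (Finset.nodup_toList _)
    have hR : ∀ u, R.1 u ≠ Set.univ → ∃ i, t i = u := by
      intro u hu
      exact List.mem_iff_get.1 (Finset.mem_toList.2 ((R.mem_supp u).2 hu))
    rw [rect_set_eq t R hR, hm _ t ht _ (fun i => R.2.1 _), rectM_symProd P t ht R hR]
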